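/- Consider the Gaussian additive model with priors {P_N} satisfying the spread assumption and M_N → ∞. If {P_N} satisfies the all-or-nothing phenomenon with critical SNR sequence {λ_N}, then lim_{N→∞} λ_N / (2 log M_N) = 1. -/

import Mathlib

open MeasureTheory ProbabilityTheory Filter Real
open scoped ENNReal NNReal

noncomputable section

/-- Vectors in `ℝ^N`. -/
abbrev V (N : ℕ) : Type := Fin N → ℝ

/-- Euclidean inner product on `ℝ^N`. -/
def inp {N : ℕ} (x y : V N) : ℝ := ∑ i, x i * y i

/-- `S` is a subset of the unit sphere of `ℝ^N`. -/
def onSphere {N : ℕ} (S : Finset (V N)) : Prop := ∀ x ∈ S, ∑ i, (x i) ^ 2 = 1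

/-- The standard Gaussian measure on `ℝ^N`. -/
def stdGaussian (N : ℕ) : Measure (V N) :=
  Measure.pi fun _ : Fin N => gaussianReal 0 1

/-- The uniform probability measure on a finite set of vectors. -/
def unifOn {N : ℕ} (S : Finset (V N)) : Measure (V N) :=
  (S.card : ℝ≥0∞)⁻¹ • ∑ x ∈ S, Measure.dirac x

/-- The joint law of `(X, Y)` where `X` is uniform on `S`, `Z` is an independent standard
Gaussian vector, and `Y = √λ • X + Z`. -/
def jointLaw (N : ℕ) (S : Finset (V N)) (lam : ℝ) : Measure (V N × V N) :=
  ((unifOn S).prod (stdGaussian N)).map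
    (fun q => (q.1, fun i => Real.sqrt lam * q.1 i + q.2 i))

/-- `Q N S lam` : the law of the observation `Y = √λ • X + Z`. -/
def Q (N : ℕ) (S : Finset (V N)) (lam : ℝ) : Measure (V N) :=
  (jointLaw N S lam).map Prod.snd

/-- Kullback–Leibler divergence `D(μ ‖ ν) = ∫ log (dμ/dν) dμ` (real-valued). -/
def klReal {α : Type*} [MeasurableSpace α] (μ ν : Measure α) : ℝ :=
  ∫ x, Real.log (μ.rnDeriv ν x).toReal ∂μ

/-- The σ-algebra generated by the observation `Y` (the second coordinate). -/
def sigmaY (N : ℕ) : MeasurableSpace (V N × V N) :=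
  MeasurableSpace.comap Prod.snd inferInstance

/-- The minimum mean squared error `E‖X - E[X | Y]‖²` at SNR `lam`. -/
def mmse (N : ℕ) (S : Finset (V N)) (lam : ℝ) : ℝ :=
  ∑ i : Fin N,
    ∫ ω, (ω.1 i - ((jointLaw N S lam)[fun ω' => ω'.1 i | sigmaY N]) ω) ^ 2
      ∂(jointLaw N S lam)

/-- The all-or-nothing phenomenon with critical SNR sequence `lam`. -/
def allOrNothing (S : ∀ N : ℕ, Finset (V N)) (lam : ℕ → ℝ) : Prop :=
  (∀ β : ℝ, 0 ≤ β → β < 1 →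
    Tendsto (fun N => mmse N (S N) (β * lam N)) atTop (nhds 1)) ∧
  (∀ β : ℝ, 1 < β →
    Tendsto (fun N => mmse N (S N) (β * lam N)) atTop (nhds 0))

/-- `limsup_N (1 / log M_N) · log P_N^{⊗2}[⟨X, X'⟩ ≥ t] ≤ c`, where `X, X'` are i.i.d.
draws from the uniform distribution on `S N`: for every `ε > 0`, eventually the probability
that the overlap is at least `t` is at most `M_N ^ (c + ε)`. -/
def overlapRateLe (S : ∀ N : ℕ, Finset (V N)) (t c : ℝ) : Prop :=
  ∀ ε : ℝ, 0 < ε → ∀ᶠ N in atTop,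
    ((unifOn (S N)).prod (unifOn (S N))) {q | t ≤ inp q.1 q.2}
      ≤ ((S N).card : ℝ≥0∞) ^ (c + ε)

/-- The spread assumption: `lim_{t→1⁻} limsup_N (1/log M_N) log P_N^{⊗2}[⟨X,X'⟩ ≥ t] ≤ -1`. -/
def spread (S : ∀ N : ℕ, Finset (V N)) : Prop :=
  ∀ ε : ℝ, 0 < ε → ∃ t₀ : ℝ, t₀ < 1 ∧ ∀ t : ℝ, t₀ < t → t < 1 →
    overlapRateLe S t (-1 + ε)

/-! ### Gaussian shift -/

lemma gauss1_shift (c : ℝ) (s : Set ℝ) (hs : MeasurableSet s) :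
    gaussianReal c 1 s = ∫⁻ y in s, ENNReal.ofReal (exp (c * y - c ^ 2 / 2)) ∂(gaussianReal 0 1) := by
  rw [gaussianReal_of_var_ne_zero c one_ne_zero, gaussianReal_of_var_ne_zero 0 one_ne_zero,
    withDensity_apply _ hs,
    setLIntegral_withDensity_eq_setLIntegral_mul _ (measurable_gaussianPDF 0 1) (by fun_prop) hs]
  refine lintegral_congr fun y => ?_
  simp only [gaussianPDF, Pi.mul_apply]
  rw [← ENNReal.ofReal_mul (gaussianPDFReal_nonneg _ _ _)]
  congr 1
  simp only [gaussianPDFReal]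
  rw [mul_assoc _ (rexp _) (rexp _), ← Real.exp_add]
  congr 2
  simp
  ring

instance (N : ℕ) : IsProbabilityMeasure (stdGaussian N) := by
  unfold _root_.stdGaussian; infer_instance

lemma integrable_exp_lin1 (c : ℝ) :
    Integrable (fun y => exp (c * y - c ^ 2 / 2)) (gaussianReal 0 1) := by
  have := (integrable_exp_mul_gaussianReal (μ := 0) (v := 1) c).mul_const (exp (-(c ^ 2 / 2)))
  refine this.congr (ae_of_all _ fun y => ?_)
  simp only
  rw [← Real.exp_add]; congr 1

/-- exponential density -/
def dens {N : ℕ} (c y : V N) : ℝ := exp (∑ i, (c i * y i - c i ^ 2 / 2))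

lemma dens_pos {N : ℕ} (c y : V N) : 0 < dens c y := exp_pos _

lemma dens_cont {N : ℕ} (c : V N) : Continuous (dens c) := by
  unfold dens; fun_prop

lemma dens_meas {N : ℕ} (c : V N) : Measurable (dens c) := (dens_cont c).measurable

lemma gaussN_shift {N : ℕ} (c : V N) :
    (stdGaussian N).map (fun z i => c i + z i) =
      (stdGaussian N).withDensity (fun y => ENNReal.ofReal (dens c y)) := by
  unfold _root_.stdGaussian
  rw [Measure.pi_map_pi (f := fun i z => c i + z) (fun i => by fun_prop)]
  simp_rw [gaussianReal_map_const_add]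
  refine Measure.pi_eq fun s hs => ?_
  rw [withDensity_apply _ (MeasurableSet.univ_pi hs), Measure.restrict_pi_pi,
    ← ofReal_integral_eq_lintegral_ofReal]
  · simp only [dens, Real.exp_sum]
    rw [integral_fintype_prod_eq_prod (f := fun i y => exp (c i * y - c i ^ 2 / 2)),
      ENNReal.ofReal_prod_of_nonneg (fun i _ => integral_nonneg fun _ => (exp_pos _).le)]
    refine Finset.prod_congr rfl fun i _ => ?_
    rw [zero_add, gauss1_shift _ _ (hs i), ofReal_integral_eq_lintegral_ofReal]
    · exact (integrable_exp_lin1 _).integrableOn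
    · exact ae_of_all _ fun _ => (exp_pos _).le
  · have h : dens c = fun y => ∏ i, exp (c i * y i - c i ^ 2 / 2) := by
      ext y; simp only [dens, Real.exp_sum]
    rw [h]
    exact Integrable.fintype_prod (f := fun i y => exp (c i * y - c i ^ 2 / 2))
      (fun i => (integrable_exp_lin1 _).integrableOn)
  · exact ae_of_all _ fun _ => (dens_pos _ _).le

lemma shift_meas {N : ℕ} (c : V N) : Measurable (fun (z : V N) i => c i + z i) :=
  measurable_pi_lambda _ fun i => measurable_const.add (measurable_pi_apply i)

lemma integral_shift {N : ℕ} (c : V N) (g : V N → ℝ) (hg : Measurable g) :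
    ∫ z, g (fun i => c i + z i) ∂(stdGaussian N) = ∫ y, dens c y * g y ∂(stdGaussian N) := by
  have h1 : ∫ z, g (fun i => c i + z i) ∂(stdGaussian N) =
      ∫ y, g y ∂((stdGaussian N).map (fun z i => c i + z i)) :=
    (integral_map (shift_meas c).aemeasurable hg.aestronglyMeasurable).symm
  rw [h1, gaussN_shift, integral_withDensity_eq_integral_toReal_smul
    (by have := dens_meas c; fun_prop) (ae_of_all _ fun _ => ENNReal.ofReal_lt_top)]
  refine integral_congr_ae (ae_of_all _ fun y => ?_)
  simp [ENNReal.toReal_ofReal (dens_pos c y).le]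

lemma integrable_shift {N : ℕ} (c : V N) (g : V N → ℝ) (hg : Measurable g) :
    Integrable (fun z => g (fun i => c i + z i)) (stdGaussian N) ↔
      Integrable (fun y => dens c y * g y) (stdGaussian N) := by
  have h1 : Integrable (fun z => g (fun i => c i + z i)) (stdGaussian N) ↔
      Integrable g ((stdGaussian N).map (fun z i => c i + z i)) :=
    (integrable_map_measure hg.aestronglyMeasurable (shift_meas c).aemeasurable).symm
  rw [h1, gaussN_shift, integrable_withDensity_iff_integrable_smul'
    (by have := dens_meas c; fun_prop) (ae_of_all _ fun _ => ENNReal.ofReal_lt_top)]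
  refine integrable_congr (ae_of_all _ fun y => ?_)
  simp [ENNReal.toReal_ofReal (dens_pos c y).le]

lemma integrable_dens_mul {N : ℕ} (c : V N) (g : V N → ℝ) (hg : Measurable g)
    (C : ℝ) (hC : ∀ y, |g y| ≤ C) : Integrable (fun y => dens c y * g y) (stdGaussian N) := by
  rw [← integrable_shift c g hg]
  exact Integrable.of_bound (hg.comp (shift_meas c)).aestronglyMeasurable C (ae_of_all _ fun z => by simpa using hC _)

lemma integrable_dens {N : ℕ} (c : V N) : Integrable (dens c) (stdGaussian N) := by
  simpa using integrable_dens_mul c (fun _ => 1) measurable_const 1 (by simp)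

lemma integral_dens {N : ℕ} (c : V N) : ∫ y, dens c y ∂(stdGaussian N) = 1 := by
  have := integral_shift c (fun _ => 1) measurable_const
  simpa using this.symm

lemma integrable_coord {N : ℕ} (i : Fin N) : Integrable (fun z : V N => z i) (stdGaussian N) := by
  unfold _root_.stdGaussian
  exact integrable_comp_eval (μ := fun _ : Fin N => gaussianReal 0 1) (f := fun x => x)
    ((memLp_id_gaussianReal 1).integrable (by simp))

lemma integral_coord {N : ℕ} (i : Fin N) : ∫ z : V N, z i ∂(stdGaussian N) = 0 := by
  unfold _root_.stdGaussian
  rw [integral_comp_eval (μ := fun _ : Fin N => gaussianReal 0 1) (f := fun x => x)]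
  · exact integral_id_gaussianReal
  · fun_prop

lemma integrable_lin {N : ℕ} (c : V N) : Integrable (fun z : V N => inp c z) (stdGaussian N) := by
  unfold inp
  exact integrable_finsetSum _ fun i _ => (integrable_coord i).const_mul _

lemma integral_lin {N : ℕ} (c : V N) : ∫ z : V N, inp c z ∂(stdGaussian N) = 0 := by
  unfold inp
  rw [integral_finsetSum _ fun i _ => (integrable_coord i).const_mul _]
  simp [integral_const_mul, integral_coord]

/-! ### Likelihoods and posterior -/

/-- likelihood ratio of signal `x` -/
def lik {N : ℕ} (a : ℝ) (x y : V N) : ℝ := dens (fun i => a * x i) y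

/-- total likelihood -/
def tot {N : ℕ} (S : Finset (V N)) (a : ℝ) (y : V N) : ℝ := ∑ x ∈ S, lik a x y

/-- posterior weight -/
def wt {N : ℕ} (S : Finset (V N)) (a : ℝ) (y x : V N) : ℝ := lik a x y / tot S a y

/-- posterior mean -/
def pm {N : ℕ} (S : Finset (V N)) (a : ℝ) (y : V N) : V N := fun i => ∑ x ∈ S, wt S a y x * x i

lemma lik_pos {N : ℕ} (a : ℝ) (x y : V N) : 0 < lik a x y := dens_pos _ _

lemma lik_eq {N : ℕ} (a : ℝ) (x y : V N) (hx : ∑ i, (x i) ^ 2 = 1) :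
    lik a x y = exp (a * inp x y - a ^ 2 / 2) := by
  unfold lik dens inp
  congr 1
  rw [Finset.sum_sub_distrib, Finset.mul_sum]
  congr 1
  · exact Finset.sum_congr rfl fun i _ => by ring
  · have : ∑ i, (a * x i) ^ 2 / 2 = a ^ 2 / 2 * ∑ i, (x i) ^ 2 := by
      rw [Finset.mul_sum]; exact Finset.sum_congr rfl fun i _ => by ring
    rw [this, hx]; ring

lemma lik_meas {N : ℕ} (a : ℝ) (x : V N) : Measurable (lik a x) := dens_meas _

lemma tot_meas {N : ℕ} (S : Finset (V N)) (a : ℝ) : Measurable (tot S a) := by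
  unfold tot
  exact Finset.measurable_fun_sum _ fun x _ => lik_meas a x

lemma wt_meas {N : ℕ} (S : Finset (V N)) (a : ℝ) (x : V N) : Measurable (fun y => wt S a y x) :=
  (lik_meas a x).div (tot_meas S a)

lemma pm_meas {N : ℕ} (S : Finset (V N)) (a : ℝ) (i : Fin N) :
    Measurable (fun y => pm S a y i) := by
  unfold pm
  exact Finset.measurable_fun_sum _ fun x _ => (wt_meas S a x).mul_const _

lemma tot_pos {N : ℕ} {S : Finset (V N)} (hS : S.Nonempty) (a : ℝ) (y : V N) :
    0 < tot S a y := Finset.sum_pos (fun x _ => lik_pos a x y) hS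

lemma wt_pos {N : ℕ} {S : Finset (V N)} (hS : S.Nonempty) (a : ℝ) (y x : V N) :
    0 < wt S a y x := div_pos (lik_pos _ _ _) (tot_pos hS _ _)

lemma wt_sum {N : ℕ} {S : Finset (V N)} (hS : S.Nonempty) (a : ℝ) (y : V N) :
    ∑ x ∈ S, wt S a y x = 1 := by
  unfold wt
  rw [← Finset.sum_div]
  exact div_self (tot_pos hS a y).ne'

lemma tot_wt {N : ℕ} {S : Finset (V N)} (hS : S.Nonempty) (a : ℝ) (y x : V N) :
    tot S a y * wt S a y x = lik a x y := by
  unfold wt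
  exact mul_div_cancel₀ _ (tot_pos hS a y).ne'

lemma tot_pm {N : ℕ} {S : Finset (V N)} (hS : S.Nonempty) (a : ℝ) (y : V N) (i : Fin N) :
    tot S a y * pm S a y i = ∑ x ∈ S, lik a x y * x i := by
  unfold pm
  rw [Finset.mul_sum]
  exact Finset.sum_congr rfl fun x _ => by rw [← mul_assoc, tot_wt hS]

lemma abs_coord_le {N : ℕ} {x : V N} (hx : ∑ i, (x i) ^ 2 = 1) (i : Fin N) : |x i| ≤ 1 := by
  have : (x i) ^ 2 ≤ 1 := by
    rw [← hx]
    exact Finset.single_le_sum (f := fun i => (x i) ^ 2) (fun j _ => sq_nonneg _) (Finset.mem_univ i)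
  exact (sq_le_one_iff_abs_le_one _).1 this

lemma pm_abs {N : ℕ} {S : Finset (V N)} (hS : S.Nonempty) (h : onSphere S) (a : ℝ) (y : V N)
    (i : Fin N) : |pm S a y i| ≤ 1 := by
  unfold pm
  calc _ ≤ ∑ x ∈ S, |wt S a y x * x i| := Finset.abs_sum_le_sum_abs _ _
    _ ≤ ∑ x ∈ S, wt S a y x := by
      refine Finset.sum_le_sum fun x hx => ?_
      rw [abs_mul, abs_of_pos (wt_pos hS _ _ _)]
      exact mul_le_of_le_one_right (wt_pos hS _ _ _).le (abs_coord_le (h x hx) i)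
    _ = 1 := wt_sum hS a y

lemma inp_pm {N : ℕ} (S : Finset (V N)) (a : ℝ) (y z : V N) :
    inp (pm S a y) z = ∑ x ∈ S, wt S a y x * inp x z := by
  unfold inp pm
  simp_rw [Finset.sum_mul, Finset.mul_sum]
  rw [Finset.sum_comm]
  exact Finset.sum_congr rfl fun x _ => Finset.sum_congr rfl fun i _ => by ring

lemma inp_comm' {N : ℕ} (x y : V N) : inp x y = inp y x :=
  Finset.sum_congr rfl fun i _ => mul_comm _ _

lemma inp_self {N : ℕ} {x : V N} (hx : ∑ i, (x i) ^ 2 = 1) : inp x x = 1 := by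
  rw [← hx]; exact Finset.sum_congr rfl fun i _ => by ring

lemma inp_le_one {N : ℕ} {x y : V N} (hx : ∑ i, (x i) ^ 2 = 1) (hy : ∑ i, (y i) ^ 2 = 1) :
    inp x y ≤ 1 := by
  have : ∑ i, (2 * (x i * y i)) ≤ ∑ i, ((x i) ^ 2 + (y i) ^ 2) :=
    Finset.sum_le_sum fun i _ => by nlinarith [sq_nonneg (x i - y i)]
  rw [Finset.sum_add_distrib, hx, hy, ← Finset.mul_sum] at this
  unfold inp; linarith

lemma inp_shift {N : ℕ} (a : ℝ) (u x z : V N) :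
    inp u (fun i => a * x i + z i) = a * inp u x + inp u z := by
  unfold inp
  rw [Finset.mul_sum, ← Finset.sum_add_distrib]
  exact Finset.sum_congr rfl fun i _ => by ring

/-- pointwise inequality for the upper bound -/
lemma pointwise_upper {N : ℕ} {S : Finset (V N)} (h : onSphere S) (a : ℝ) (x z : V N)
    (hx : x ∈ S) :
    a ^ 2 / 2 + a * inp x z ≤ log S.card + tot S a z / S.card - 1 +
      a ^ 2 * inp (pm S a (fun i => a * x i + z i)) x := by
  have hS : S.Nonempty := ⟨x, hx⟩
  have hM : (0 : ℝ) < S.card := by exact_mod_cast hS.card_pos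
  set y : V N := fun i => a * x i + z i with hy
  have h1 : a ^ 2 / 2 + a * inp x z ≤ log (tot S a y) := by
    rw [Real.le_log_iff_exp_le (tot_pos hS _ _)]
    calc _ = lik a x y := by
            rw [lik_eq a x y (h x hx), hy, inp_shift, inp_self (h x hx)]; congr 1; ring
      _ ≤ _ := Finset.single_le_sum (f := fun x => lik a x y) (fun u _ => (lik_pos _ _ _).le) hx
  have h2 : log (tot S a z) ≤ log S.card + tot S a z / S.card - 1 := by
    have := Real.log_le_sub_one_of_pos (div_pos (tot_pos hS a z) hM)
    rw [Real.log_div (tot_pos hS a z).ne' hM.ne'] at this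
    linarith
  have h3 : tot S a y * exp (-(a ^ 2 * inp (pm S a y) x)) ≤ tot S a z := by
    have e1 : tot S a z = tot S a y * ∑ u ∈ S, wt S a y u * exp (-(a ^ 2 * inp u x)) := by
      rw [Finset.mul_sum]
      refine Finset.sum_congr rfl fun u hu => ?_
      rw [← mul_assoc, tot_wt hS, lik_eq _ _ _ (h u hu), lik_eq _ _ _ (h u hu), ← Real.exp_add,
        hy, inp_shift]
      congr 1; ring
    rw [e1]
    refine mul_le_mul_of_nonneg_left ?_ (tot_pos hS _ _).le
    have := convexOn_exp.map_sum_le (t := S) (w := fun u => wt S a y u)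
      (p := fun u => -(a ^ 2 * inp u x)) (fun u _ => (wt_pos hS _ _ _).le) (wt_sum hS a y)
      (fun _ _ => Set.mem_univ _)
    simp only [smul_eq_mul] at this
    refine le_trans (le_of_eq ?_) this
    congr 1
    rw [inp_pm, Finset.mul_sum, ← Finset.sum_neg_distrib]
    exact Finset.sum_congr rfl fun u _ => by ring
  have h4 : log (tot S a y) - a ^ 2 * inp (pm S a y) x ≤ log (tot S a z) := by
    have := Real.log_le_log (mul_pos (tot_pos hS _ _) (exp_pos _)) h3
    rw [Real.log_mul (tot_pos hS _ _).ne' (exp_pos _).ne', Real.log_exp] at this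
    linarith
  linarith

open Classical in
/-- near neighbours -/
def nbr {N : ℕ} (S : Finset (V N)) (t : ℝ) (u : V N) : Finset (V N) := S.filter fun x => t ≤ inp x u

/-- finite Gibbs/Fano inequality -/
lemma fano_fin {N : ℕ} {S : Finset (V N)} (h : onSphere S) (hS : S.Nonempty) (t : ℝ) (ht : t < 1)
    (w : V N → ℝ) (hw : ∀ x, 0 < w x) (hsum : ∑ x ∈ S, w x = 1) :
    -∑ x ∈ S, w x * log (w x) ≤ log 2 +
      log S.card / (1 - t) * (1 - ∑ x ∈ S, ∑ u ∈ S, w x * w u * inp x u) +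
      ∑ u ∈ S, w u * log (nbr S t u).card := by
  classical
  have hM : (0 : ℝ) < S.card := by exact_mod_cast hS.card_pos
  have hlM : 0 ≤ log (S.card : ℝ) := Real.log_natCast_nonneg _
  have hB : ∀ u ∈ S, (0 : ℝ) < (nbr S t u).card := by
    intro u hu
    have : u ∈ nbr S t u := by
      simp only [nbr, Finset.mem_filter]
      exact ⟨hu, by rw [inp_self (h u hu)]; exact ht.le⟩
    exact_mod_cast Finset.card_pos.2 ⟨u, this⟩
  have hlB : ∀ u, 0 ≤ log ((nbr S t u).card : ℝ) := fun u => Real.log_natCast_nonneg _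
  let r : V N → V N → ℝ := fun x u =>
    (1 / 2) * (1 / (S.card : ℝ) + (if x ∈ nbr S t u then 1 / ((nbr S t u).card : ℝ) else 0 : ℝ))
  have hrpos : ∀ x u, 0 < r x u := by
    intro x u
    have : (0 : ℝ) ≤ if x ∈ nbr S t u then 1 / ((nbr S t u).card : ℝ) else 0 := by
      split_ifs <;> positivity
    have h2 : (0 : ℝ) < 1 / S.card := by positivity
    simp only [r]; linarith
  have hrsum : ∀ u ∈ S, ∑ x ∈ S, r x u = 1 := by
    intro u hu
    simp only [r]
    rw [← Finset.mul_sum, Finset.sum_add_distrib, ← Finset.sum_filter]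
    have : S.filter (fun x => x ∈ nbr S t u) = nbr S t u := by
      ext x; simp only [nbr, Finset.mem_filter]; tauto
    rw [this, Finset.sum_const, Finset.sum_const, nsmul_eq_mul, nsmul_eq_mul]
    have := hB u hu
    field_simp; norm_num
  have hrlog : ∀ x ∈ S, ∀ u ∈ S, -log (r x u) ≤ log 2 + log S.card / (1 - t) * (1 - inp x u)
      + log (nbr S t u).card := by
    intro x hx u hu
    have h1t : 0 < 1 - t := by linarith
    have hxu := inp_le_one (h x hx) (h u hu)
    by_cases hc : x ∈ nbr S t u
    · have hl : log (1 / 2 * (1 / ((nbr S t u).card : ℝ))) ≤ log (r x u) := by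
        have := hB u hu
        refine Real.log_le_log (by positivity) ?_
        simp only [r, if_pos hc]
        have : (0 : ℝ) < 1 / S.card := by positivity
        linarith
      rw [Real.log_mul (by norm_num) (by have := hB u hu; positivity), one_div, one_div,
        Real.log_inv, Real.log_inv] at hl
      have : 0 ≤ log S.card / (1 - t) * (1 - inp x u) :=
        mul_nonneg (div_nonneg hlM h1t.le) (by linarith)
      linarith
    · have hl : log (1 / 2 * (1 / (S.card : ℝ))) ≤ log (r x u) := by
        refine Real.log_le_log (by positivity) ?_
        simp only [r, if_neg hc]
        linarith
      rw [Real.log_mul (by norm_num) (by positivity), one_div, one_div,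
        Real.log_inv, Real.log_inv] at hl
      have hlt : inp x u < t := by
        simp only [nbr, Finset.mem_filter, not_and, not_le] at hc
        exact hc hx
      have : log S.card ≤ log S.card / (1 - t) * (1 - inp x u) := by
        rw [div_mul_eq_mul_div, le_div_iff₀ h1t]
        exact mul_le_mul_of_nonneg_left (by linarith) hlM
      have := hlB u
      linarith
  have hg : ∑ x ∈ S, ∑ u ∈ S, w x * w u * (log (r x u) - log (w x)) ≤ 0 := by
    calc _ ≤ ∑ x ∈ S, ∑ u ∈ S, (w u * r x u - w x * w u) := by
          refine Finset.sum_le_sum fun x hx => Finset.sum_le_sum fun u hu => ?_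
          have h1 := Real.log_le_sub_one_of_pos (div_pos (hrpos x u) (hw x))
          rw [Real.log_div (hrpos x u).ne' (hw x).ne'] at h1
          have h2 := mul_le_mul_of_nonneg_left h1 (mul_pos (hw x) (hw u)).le
          refine h2.trans (le_of_eq ?_)
          have := (hw x).ne'
          field_simp
      _ = 0 := by
          simp_rw [Finset.sum_sub_distrib]
          rw [Finset.sum_comm]
          simp_rw [← Finset.mul_sum]
          rw [← Finset.sum_mul, hsum, Finset.sum_congr rfl fun u hu => by rw [hrsum u hu, mul_one],
            hsum]; norm_num
  have e1 : ∑ x ∈ S, ∑ u ∈ S, w x * w u * log (w x) = ∑ x ∈ S, w x * log (w x) := by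
    refine Finset.sum_congr rfl fun x _ => ?_
    calc _ = (w x * log (w x)) * ∑ u ∈ S, w u := by
            rw [Finset.mul_sum]; exact Finset.sum_congr rfl fun u _ => by ring
      _ = _ := by rw [hsum, mul_one]
  have e0 : ∑ x ∈ S, ∑ u ∈ S, w x * w u = 1 := by
    simp_rw [← Finset.mul_sum, hsum, mul_one]; exact hsum
  have e2 : ∑ x ∈ S, ∑ u ∈ S, w x * w u * log (nbr S t u).card
      = ∑ u ∈ S, w u * log (nbr S t u).card := by
    rw [Finset.sum_comm]
    refine Finset.sum_congr rfl fun u _ => ?_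
    calc _ = (w u * log (nbr S t u).card) * ∑ x ∈ S, w x := by
            rw [Finset.mul_sum]; exact Finset.sum_congr rfl fun u _ => by ring
      _ = _ := by rw [hsum, mul_one]
  have hfin : ∑ x ∈ S, ∑ u ∈ S, w x * w u * (-log (r x u)) ≤
      ∑ x ∈ S, ∑ u ∈ S, w x * w u * (log 2 + log S.card / (1 - t) * (1 - inp x u)
      + log (nbr S t u).card) :=
    Finset.sum_le_sum fun x hx => Finset.sum_le_sum fun u hu =>
      mul_le_mul_of_nonneg_left (hrlog x hx u hu) (mul_pos (hw x) (hw u)).le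
  have e3 : ∑ x ∈ S, ∑ u ∈ S, w x * w u * (log 2 + log S.card / (1 - t) * (1 - inp x u)
      + log (nbr S t u).card) = log 2 * ∑ x ∈ S, ∑ u ∈ S, w x * w u +
      log S.card / (1 - t) * (∑ x ∈ S, ∑ u ∈ S, w x * w u - ∑ x ∈ S, ∑ u ∈ S, w x * w u * inp x u)
      + ∑ x ∈ S, ∑ u ∈ S, w x * w u * log (nbr S t u).card := by
    simp_rw [Finset.mul_sum, ← Finset.sum_sub_distrib, Finset.mul_sum, ← Finset.sum_add_distrib]
    exact Finset.sum_congr rfl fun x _ => Finset.sum_congr rfl fun u _ => by ring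
  rw [e3, e0, e2, mul_one] at hfin
  simp_rw [mul_sub, Finset.sum_sub_distrib] at hg
  rw [e1] at hg
  simp_rw [mul_neg, Finset.sum_neg_distrib] at hfin
  linarith

/-- pointwise inequality for the lower bound -/
lemma pointwise_lower {N : ℕ} {S : Finset (V N)} (h : onSphere S) (hS : S.Nonempty) (a t : ℝ)
    (ht : t < 1) (y : V N) :
    tot S a y * log S.card + tot S a y - S.card - ∑ x ∈ S, lik a x y * (a * inp x y - a ^ 2 / 2) ≤
      log 2 * tot S a y + log S.card / (1 - t) *
        (tot S a y * (1 - ∑ i, (pm S a y i) ^ 2)) +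
      ∑ u ∈ S, lik a u y * log (nbr S t u).card := by
  have hM : (0 : ℝ) < S.card := by exact_mod_cast hS.card_pos
  have hT := tot_pos hS a y
  have h1 := fano_fin h hS t ht (wt S a y) (wt_pos hS a y) (wt_sum hS a y)
  have e1 : ∑ x ∈ S, ∑ u ∈ S, wt S a y x * wt S a y u * inp x u = ∑ i, (pm S a y i) ^ 2 := by
    have : ∑ i, (pm S a y i) ^ 2 = inp (pm S a y) (pm S a y) :=
      Finset.sum_congr rfl fun i _ => by ring
    rw [this, inp_pm]
    refine Finset.sum_congr rfl fun x _ => ?_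
    rw [inp_comm', inp_pm, Finset.mul_sum]
    exact Finset.sum_congr rfl fun u _ => by rw [inp_comm' u x]; ring
  rw [e1] at h1
  have h2 := mul_le_mul_of_nonneg_left h1 hT.le
  have e2 : tot S a y * -∑ x ∈ S, wt S a y x * log (wt S a y x) =
      tot S a y * log (tot S a y) - ∑ x ∈ S, lik a x y * (a * inp x y - a ^ 2 / 2) := by
    have : tot S a y * log (tot S a y) = ∑ x ∈ S, lik a x y * log (tot S a y) := by
      rw [← Finset.sum_mul]; rfl
    rw [this, ← Finset.sum_sub_distrib, mul_neg, Finset.mul_sum, ← Finset.sum_neg_distrib]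
    refine Finset.sum_congr rfl fun x hx => ?_
    rw [← mul_assoc, tot_wt hS, wt, Real.log_div (lik_pos _ _ _).ne' hT.ne']
    conv_lhs => rw [lik_eq a x y (h x hx), Real.log_exp, ← lik_eq a x y (h x hx)]
    ring
  have e3 : tot S a y * ∑ u ∈ S, wt S a y u * log (nbr S t u).card =
      ∑ u ∈ S, lik a u y * log (nbr S t u).card := by
    rw [Finset.mul_sum]
    exact Finset.sum_congr rfl fun u _ => by rw [← mul_assoc, tot_wt hS]
  rw [e2, mul_add, e3] at h2
  have h3 : tot S a y * log S.card + tot S a y - S.card ≤ tot S a y * log (tot S a y) := by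
    have := Real.log_le_sub_one_of_pos (div_pos hM hT)
    rw [Real.log_div hM.ne' hT.ne'] at this
    have := mul_le_mul_of_nonneg_left this hT.le
    have e : tot S a y * ((S.card : ℝ) / tot S a y - 1) = S.card - tot S a y := by
      field_simp
    rw [e] at this
    linarith
  linarith

/-! ### The joint law and the mmse -/

lemma finset_sum_prod {N : ℕ} {β : Type*} [MeasurableSpace β] (S : Finset (V N)) (ν : Measure β)
    [SFinite ν] : (∑ x ∈ S, Measure.dirac x : Measure (V N)).prod ν =
      ∑ x ∈ S, ν.map (Prod.mk x) := by
  classical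
  induction S using Finset.induction_on with
  | empty => simp
  | insert x S hx ih =>
    rw [Finset.sum_insert hx, Finset.sum_insert hx, Measure.add_prod, ih, Measure.dirac_prod]

lemma map_finset_sum' {α β ι : Type*} [MeasurableSpace α] [MeasurableSpace β] (s : Finset ι)
    (μ : ι → Measure α) (f : α → β) (hf : Measurable f) :
    (∑ i ∈ s, μ i).map f = ∑ i ∈ s, (μ i).map f := by
  classical
  induction s using Finset.induction_on with
  | empty => simp
  | insert x S hx ih =>
    rw [Finset.sum_insert hx, Finset.sum_insert hx, Measure.map_add _ _ hf, ih]

lemma jointLaw_eq (N : ℕ) (S : Finset (V N)) (lam : ℝ) :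
    jointLaw N S lam = (S.card : ℝ≥0∞)⁻¹ • ∑ x ∈ S,
      ((_root_.stdGaussian N).withDensity
        (fun y => ENNReal.ofReal (lik (√lam) x y))).map (Prod.mk x) := by
  have hφ : Measurable (fun q : V N × V N => (q.1, fun i => √lam * q.1 i + q.2 i)) := by
    refine measurable_fst.prodMk (measurable_pi_lambda _ fun i => ?_)
    exact (((measurable_pi_apply i).comp measurable_fst).const_mul _).add
      ((measurable_pi_apply i).comp measurable_snd)
  unfold jointLaw unifOn
  rw [Measure.prod_smul_left, finset_sum_prod, Measure.map_smul, map_finset_sum' _ _ _ hφ]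
  congr 1
  refine Finset.sum_congr rfl fun x _ => ?_
  unfold lik
  rw [← gaussN_shift, Measure.map_map hφ measurable_prodMk_left,
    Measure.map_map measurable_prodMk_left (shift_meas _)]
  rfl

lemma integrable_joint {N : ℕ} {S : Finset (V N)} (hS : S.Nonempty) (lam : ℝ)
    (g : V N × V N → ℝ) (hg : Measurable g)
    (hi : ∀ x ∈ S, Integrable (fun y => lik (√lam) x y * g (x, y)) (_root_.stdGaussian N)) :
    Integrable g (jointLaw N S lam) := by
  rw [jointLaw_eq]
  refine Integrable.smul_measure ?_ (by simp [hS.ne_empty])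
  rw [integrable_finsetSum_measure]
  intro x hx
  rw [integrable_map_measure hg.aestronglyMeasurable measurable_prodMk_left.aemeasurable,
    integrable_withDensity_iff_integrable_smul'
    (by have := lik_meas (√lam) x; fun_prop) (ae_of_all _ fun _ => ENNReal.ofReal_lt_top)]
  refine (hi x hx).congr (ae_of_all _ fun y => ?_)
  simp [ENNReal.toReal_ofReal (lik_pos _ x y).le]

lemma integral_joint {N : ℕ} {S : Finset (V N)} (lam : ℝ)
    (g : V N × V N → ℝ) (hg : Measurable g)
    (hi : ∀ x ∈ S, Integrable (fun y => lik (√lam) x y * g (x, y)) (_root_.stdGaussian N)) :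
    ∫ ω, g ω ∂(jointLaw N S lam) =
      (S.card : ℝ)⁻¹ * ∑ x ∈ S, ∫ y, lik (√lam) x y * g (x, y) ∂(_root_.stdGaussian N) := by
  rw [jointLaw_eq, integral_smul_measure, integral_finsetSum_measure]
  · simp only [ENNReal.toReal_inv, ENNReal.toReal_natCast, smul_eq_mul]
    congr 1
    refine Finset.sum_congr rfl fun x _ => ?_
    rw [integral_map measurable_prodMk_left.aemeasurable hg.aestronglyMeasurable,
      integral_withDensity_eq_integral_toReal_smul
    (by have := lik_meas (√lam) x; fun_prop) (ae_of_all _ fun _ => ENNReal.ofReal_lt_top)]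
    refine integral_congr_ae (ae_of_all _ fun y => ?_)
    simp [ENNReal.toReal_ofReal (lik_pos _ x y).le]
  · intro x hx
    rw [integrable_map_measure hg.aestronglyMeasurable measurable_prodMk_left.aemeasurable,
      integrable_withDensity_iff_integrable_smul'
      (by have := lik_meas (√lam) x; fun_prop) (ae_of_all _ fun _ => ENNReal.ofReal_lt_top)]
    refine (hi x hx).congr (ae_of_all _ fun y => ?_)
    simp [ENNReal.toReal_ofReal (lik_pos _ x y).le]

lemma integrable_lik_mul {N : ℕ} (a : ℝ) (x : V N) (g : V N → ℝ) (hg : Measurable g)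
    (C : ℝ) (hC : ∀ y, |g y| ≤ C) :
    Integrable (fun y => lik a x y * g y) (_root_.stdGaussian N) :=
  integrable_dens_mul _ g hg C hC

lemma jointLaw_finite {N : ℕ} {S : Finset (V N)} (hS : S.Nonempty) (lam : ℝ) :
    IsFiniteMeasure (jointLaw N S lam) := by
  have h := integrable_joint hS lam (fun _ => 1) measurable_const
    (fun x _ => integrable_lik_mul _ x _ measurable_const 1 (by simp))
  rw [integrable_const_iff] at h
  simpa using h

lemma sigmaY_le (N : ℕ) : sigmaY N ≤ (inferInstance : MeasurableSpace (V N × V N)) :=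
  measurable_snd.comap_le

lemma condExp_eq {N : ℕ} {S : Finset (V N)} (hS : S.Nonempty) (h : onSphere S) (lam : ℝ)
    (i : Fin N) :
    (fun ω : V N × V N => pm S (√lam) ω.2 i) =ᵐ[jointLaw N S lam]
      (jointLaw N S lam)[fun ω' => ω'.1 i | sigmaY N] := by
  have := jointLaw_finite hS lam
  have hm1 : Measurable (fun ω : V N × V N => ω.1 i) := (measurable_pi_apply i).comp measurable_fst
  have hm2 : Measurable (fun ω : V N × V N => pm S (√lam) ω.2 i) :=
    (pm_meas S _ i).comp measurable_snd
  have hi2 : Integrable (fun ω : V N × V N => pm S (√lam) ω.2 i) (jointLaw N S lam) :=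
    integrable_joint hS lam _ hm2 fun x _ =>
      integrable_lik_mul _ x _ (pm_meas S _ i) 1 fun y => pm_abs hS h _ y i
  refine ae_eq_condExp_of_forall_setIntegral_eq (sigmaY_le N) ?_ ?_ ?_ ?_
  · exact integrable_joint hS lam _ hm1 fun x _ =>
      integrable_lik_mul _ x (fun _ => x i) measurable_const |x i| fun y => le_rfl
  · intro s _ _
    exact hi2.integrableOn
  · rintro s ⟨A, hA, rfl⟩ _
    have hA' : MeasurableSet (Prod.snd ⁻¹' A : Set (V N × V N)) := measurable_snd hA
    rw [← integral_indicator hA', ← integral_indicator hA']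
    have hb : ∀ (g : V N → ℝ) (C : ℝ) (y : V N), |g y| ≤ C → |A.indicator g y| ≤ C := by
      intro g C y hy
      by_cases hyA : y ∈ A
      · simpa [hyA] using hy
      · simpa [hyA] using (abs_nonneg _).trans hy
    have i1 : ∀ x ∈ S, Integrable (fun y => lik (√lam) x y *
        (A.indicator (fun y => pm S (√lam) y i) y)) (_root_.stdGaussian N) := fun x _ =>
      integrable_lik_mul _ x _ ((pm_meas S _ i).indicator hA) 1
        fun y => hb _ _ _ (pm_abs hS h _ y i)
    have i2 : ∀ x ∈ S, Integrable (fun y => lik (√lam) x y *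
        (A.indicator (fun _ => x i) y)) (_root_.stdGaussian N) := fun x _ =>
      integrable_lik_mul _ x _ (measurable_const.indicator hA) |x i|
        fun y => hb _ _ _ le_rfl
    rw [integral_joint lam _ (hm2.indicator hA') i1, integral_joint lam _ (hm1.indicator hA') i2]
    congr 1
    refine (integral_finsetSum _ i1).symm.trans (Eq.trans ?_ (integral_finsetSum _ i2))
    refine integral_congr_ae (ae_of_all _ fun y => ?_)
    change ∑ x ∈ S, lik (√lam) x y * A.indicator (fun y => pm S (√lam) y i) y =
      ∑ x ∈ S, lik (√lam) x y * A.indicator (fun _ => x i) y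
    by_cases hyA : y ∈ A
    · simp only [Set.indicator_of_mem hyA]
      rw [← Finset.sum_mul]
      exact tot_pm hS _ y i
    · simp only [Set.indicator_of_notMem hyA]
  · refine StronglyMeasurable.aestronglyMeasurable ?_
    refine Measurable.stronglyMeasurable ?_
    exact (pm_meas S (√lam) i).comp (comap_measurable Prod.snd)

lemma pm_sq_le {N : ℕ} {S : Finset (V N)} (hS : S.Nonempty) (h : onSphere S) (a : ℝ) (y : V N) :
    |1 - ∑ i, (pm S a y i) ^ 2| ≤ 1 + N := by
  have h0 : 0 ≤ ∑ i, (pm S a y i) ^ 2 := Finset.sum_nonneg fun i _ => sq_nonneg _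
  have h1 : ∑ i, (pm S a y i) ^ 2 ≤ ∑ i : Fin N, (1 : ℝ) :=
    Finset.sum_le_sum fun i _ => (sq_le_one_iff_abs_le_one _).2 (pm_abs hS h a y i)
  simp at h1
  rw [abs_le]; constructor <;> linarith [(Nat.cast_nonneg N : (0 : ℝ) ≤ N)]

lemma pm_sq_meas {N : ℕ} (S : Finset (V N)) (a : ℝ) :
    Measurable (fun y => 1 - ∑ i, (pm S a y i) ^ 2) :=
  measurable_const.sub (Finset.measurable_fun_sum _ fun i _ => (pm_meas S a i).pow_const 2)

lemma integrable_tot_mul {N : ℕ} (S : Finset (V N)) (a : ℝ) (g : V N → ℝ) (hg : Measurable g)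
    (C : ℝ) (hC : ∀ y, |g y| ≤ C) :
    Integrable (fun y => tot S a y * g y) (_root_.stdGaussian N) := by
  unfold tot
  simp_rw [Finset.sum_mul]
  exact integrable_finsetSum _ fun x _ => integrable_lik_mul a x g hg C hC

lemma mmse_eq {N : ℕ} {S : Finset (V N)} (hS : S.Nonempty) (h : onSphere S) (lam : ℝ) :
    mmse N S lam = (S.card : ℝ)⁻¹ *
      ∫ y, tot S (√lam) y * (1 - ∑ i, (pm S (√lam) y i) ^ 2) ∂(_root_.stdGaussian N) := by
  have key : ∀ i : Fin N, ∀ x ∈ S, Integrable (fun y => lik (√lam) x y *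
      (x i - pm S (√lam) y i) ^ 2) (_root_.stdGaussian N) := by
    intro i x hx
    refine integrable_lik_mul _ x _ ((measurable_const.sub (pm_meas S _ i)).pow_const 2) 4 ?_
    intro y
    have h1 := abs_le.1 (abs_coord_le (h x hx) i)
    have h2 := abs_le.1 (pm_abs hS h (√lam) y i)
    rw [abs_of_nonneg (sq_nonneg _)]
    nlinarith
  have step : mmse N S lam = ∑ i : Fin N, (S.card : ℝ)⁻¹ * ∑ x ∈ S,
      ∫ y, lik (√lam) x y * (x i - pm S (√lam) y i) ^ 2 ∂(_root_.stdGaussian N) := by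
    unfold mmse
    refine Finset.sum_congr rfl fun i _ => ?_
    have hm : Measurable (fun ω : V N × V N => (ω.1 i - pm S (√lam) ω.2 i) ^ 2) :=
      (((measurable_pi_apply i).comp measurable_fst).sub
        ((pm_meas S _ i).comp measurable_snd)).pow_const 2
    rw [← integral_joint lam _ hm (key i)]
    refine integral_congr_ae ?_
    filter_upwards [condExp_eq hS h lam i] with ω hω
    rw [← hω]
  rw [step, ← Finset.mul_sum]
  congr 1
  rw [Finset.sum_congr rfl fun i _ => (integral_finsetSum S (key i)).symm,
    ← integral_finsetSum _ fun i _ => integrable_finsetSum _ (key i)]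
  refine integral_congr_ae (ae_of_all _ fun y => ?_)
  simp only
  set m := pm S (√lam) y with hm
  have e : ∀ i, ∑ x ∈ S, lik (√lam) x y * (x i - m i) ^ 2 =
      ∑ x ∈ S, lik (√lam) x y * x i ^ 2 - tot S (√lam) y * m i ^ 2 := by
    intro i
    have h1 := tot_pm hS (√lam) y i
    rw [← hm] at h1
    have h2 : ∑ x ∈ S, lik (√lam) x y * (x i - m i) ^ 2 =
      ∑ x ∈ S, lik (√lam) x y * x i ^ 2 - 2 * m i * ∑ x ∈ S, lik (√lam) x y * x i
        + (∑ x ∈ S, lik (√lam) x y) * m i ^ 2 := by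
      rw [Finset.mul_sum, Finset.sum_mul, ← Finset.sum_sub_distrib, ← Finset.sum_add_distrib]
      exact Finset.sum_congr rfl fun x _ => by ring
    rw [h2, ← h1]
    change _ + tot S (√lam) y * _ = _
    ring
  rw [Finset.sum_congr rfl fun i _ => e i, Finset.sum_sub_distrib, ← Finset.mul_sum, mul_sub,
    mul_one, Finset.sum_comm]
  congr 1
  refine Finset.sum_congr rfl fun x hx => ?_
  rw [← Finset.mul_sum, h x hx, mul_one]

/-! ### The two nonasymptotic bounds -/

lemma integral_lik {N : ℕ} (a : ℝ) (x : V N) : ∫ y, lik a x y ∂(_root_.stdGaussian N) = 1 :=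
  integral_dens _

lemma integrable_lik {N : ℕ} (a : ℝ) (x : V N) : Integrable (lik a x) (_root_.stdGaussian N) :=
  integrable_dens _

lemma integrable_tot {N : ℕ} (S : Finset (V N)) (a : ℝ) :
    Integrable (tot S a) (_root_.stdGaussian N) := by
  unfold tot; exact integrable_finsetSum _ fun x _ => integrable_lik a x

lemma integral_tot {N : ℕ} (S : Finset (V N)) (a : ℝ) :
    ∫ y, tot S a y ∂(_root_.stdGaussian N) = S.card := by
  unfold tot; rw [integral_finsetSum _ fun x _ => integrable_lik a x]; simp [integral_lik]

lemma inp_meas {N : ℕ} (x : V N) : Measurable (fun y => inp x y) := by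
  unfold inp
  exact Finset.measurable_fun_sum _ fun i _ => (measurable_pi_apply i).const_mul _

lemma upper_bound {N : ℕ} {S : Finset (V N)} (hS : S.Nonempty) (h : onSphere S) (lam : ℝ)
    (hl : 0 ≤ lam) : lam / 2 ≤ log S.card + lam * (1 - mmse N S lam) := by
  have hM : (0 : ℝ) < S.card := by exact_mod_cast hS.card_pos
  set a := √lam with ha
  have ha2 : a ^ 2 = lam := Real.sq_sqrt hl
  have hmeas : ∀ x, Measurable (fun y => inp (pm S a y) x) := fun x => by
    unfold inp
    exact Finset.measurable_fun_sum _ fun i _ => (pm_meas S a i).mul_const _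
  have hbd : ∀ x ∈ S, ∀ y, |inp (pm S a y) x| ≤ N := by
    intro x hx y
    unfold inp
    calc _ ≤ ∑ i, |pm S a y i * x i| := Finset.abs_sum_le_sum_abs _ _
      _ ≤ ∑ i : Fin N, (1 : ℝ) := Finset.sum_le_sum fun i _ => by
          rw [abs_mul]
          exact mul_le_one₀ (pm_abs hS h a y i) (abs_nonneg _) (abs_coord_le (h x hx) i)
      _ = N := by simp
  have hinteg : ∀ x ∈ S, Integrable (fun y => lik a x y * inp (pm S a y) x)
      (_root_.stdGaussian N) := fun x hx => integrable_lik_mul a x _ (hmeas x) N (hbd x hx)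
  have hx : ∀ x ∈ S, lam / 2 ≤ log S.card +
      lam * ∫ y, lik a x y * inp (pm S a y) x ∂(_root_.stdGaussian N) := by
    intro x hx
    have hi1 : Integrable (fun z => a ^ 2 / 2 + a * inp x z) (_root_.stdGaussian N) :=
      (integrable_const _).add ((integrable_lin x).const_mul a)
    have hi2 : Integrable (fun z : V N => inp (pm S a (fun i => a * x i + z i)) x)
        (_root_.stdGaussian N) :=
      (integrable_shift (fun i => a * x i) _ (hmeas x)).2 (hinteg x hx)
    have hi4 : Integrable (fun z : V N => log S.card + tot S a z / S.card)
        (_root_.stdGaussian N) :=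
      (integrable_const _).add ((integrable_tot S a).div_const _)
    have hi3 : Integrable (fun z : V N => log S.card + tot S a z / S.card - 1)
        (_root_.stdGaussian N) :=
      ((integrable_const _).add ((integrable_tot S a).div_const _)).sub (integrable_const _)
    have := integral_mono hi1 (hi3.add (hi2.const_mul (a ^ 2)))
      (fun z => pointwise_upper h a x z hx)
    rw [integral_add (integrable_const _) ((integrable_lin x).const_mul a), integral_const_mul,
      integral_lin] at this
    simp only [Pi.add_apply] at this
    rw [integral_add hi3 (hi2.const_mul (a ^ 2)), integral_const_mul,
      integral_sub hi4 (integrable_const _),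
      integral_add (integrable_const _) ((integrable_tot S a).div_const _), integral_div (S.card : ℝ) (tot S a),
      integral_tot, integral_shift (fun i => a * x i) _ (hmeas x), div_self hM.ne'] at this
    simp only [integral_const, probReal_univ, smul_eq_mul, one_mul, mul_zero, add_zero, ha2] at this
    change _ ≤ _ + lam * ∫ y, lik a x y * inp (pm S a y) x ∂(_root_.stdGaussian N) at this
    linarith
  have hsum := Finset.sum_le_sum hx
  rw [Finset.sum_add_distrib, ← Finset.mul_sum, ← integral_finsetSum _ hinteg] at hsum
  simp only [Finset.sum_const, nsmul_eq_mul] at hsum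
  have e : ∀ y, ∑ x ∈ S, lik a x y * inp (pm S a y) x = tot S a y * ∑ i, (pm S a y i) ^ 2 := by
    intro y
    simp only [inp, Finset.mul_sum]
    rw [Finset.sum_comm]
    refine Finset.sum_congr rfl fun i _ => ?_
    rw [pow_two, ← mul_assoc, tot_pm hS, Finset.sum_mul]
    exact Finset.sum_congr rfl fun x _ => by ring
  have e2 : ∫ y, ∑ x ∈ S, lik a x y * inp (pm S a y) x ∂(_root_.stdGaussian N) =
      S.card * (1 - mmse N S lam) := by
    rw [mmse_eq hS h, ← ha, mul_sub, mul_one, ← mul_assoc, mul_inv_cancel₀ hM.ne', one_mul]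
    rw [← integral_tot S a, ← integral_sub (integrable_tot S a)
      (integrable_tot_mul S a _ (pm_sq_meas S a) _ (pm_sq_le hS h a))]
    refine integral_congr_ae (ae_of_all _ fun y => ?_)
    simp only [e]; ring
  rw [e2] at hsum
  have : (S.card : ℝ) * (lam / 2) ≤ S.card * (log S.card + lam * (1 - mmse N S lam)) := by
    linarith
  exact le_of_mul_le_mul_left this hM

lemma lower_bound {N : ℕ} {S : Finset (V N)} (hS : S.Nonempty) (h : onSphere S) (lam : ℝ)
    (hl : 0 ≤ lam) (t : ℝ) (ht : t < 1) :
    log S.card ≤ lam / 2 + log 2 + log S.card / (1 - t) * mmse N S lam +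
      (S.card : ℝ)⁻¹ * ∑ u ∈ S, log (nbr S t u).card := by
  have hM : (0 : ℝ) < S.card := by exact_mod_cast hS.card_pos
  set a := √lam with ha
  have ha2 : a ^ 2 = lam := Real.sq_sqrt hl
  have hlm : ∀ x : V N, Measurable (fun y => a * inp x y - a ^ 2 / 2) := fun x =>
    ((inp_meas x).const_mul a).sub_const _
  have hsh : ∀ x ∈ S, ∀ z, a * inp x (fun i => a * x i + z i) - a ^ 2 / 2 =
      a ^ 2 / 2 + a * inp x z := by
    intro x hx z
    rw [inp_shift, inp_self (h x hx)]; ring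
  have hi1 : ∀ x ∈ S, Integrable (fun y => lik a x y * (a * inp x y - a ^ 2 / 2))
      (_root_.stdGaussian N) := by
    intro x hx
    refine (integrable_shift (fun i => a * x i) _ (hlm x)).1 ?_
    simp only [hsh x hx]
    exact (integrable_const _).add ((integrable_lin x).const_mul a)
  have hv1 : ∀ x ∈ S, ∫ y, lik a x y * (a * inp x y - a ^ 2 / 2) ∂(_root_.stdGaussian N)
      = lam / 2 := by
    intro x hx
    refine (integral_shift (fun i => a * x i) _ (hlm x)).symm.trans ?_
    simp only [hsh x hx]
    rw [integral_add (integrable_const _) ((integrable_lin x).const_mul a), integral_const_mul,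
      integral_lin, ← ha2]
    simp
  have hT := integrable_tot S a
  have hA' : Integrable (fun y => tot S a y * log S.card + tot S a y)
      (_root_.stdGaussian N) := (hT.mul_const _).add hT
  have hA : Integrable (fun y => tot S a y * log S.card + tot S a y - S.card)
      (_root_.stdGaussian N) := ((hT.mul_const _).add hT).sub (integrable_const _)
  have hB : Integrable (fun y => ∑ x ∈ S, lik a x y * (a * inp x y - a ^ 2 / 2))
      (_root_.stdGaussian N) := integrable_finsetSum _ hi1
  have hC := integrable_tot_mul S a _ (pm_sq_meas S a) _ (pm_sq_le hS h a)
  have hD : ∀ u ∈ S, Integrable (fun y => lik a u y * log (nbr S t u).card)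
      (_root_.stdGaussian N) := fun u _ => (integrable_lik a u).mul_const _
  have hD' := integrable_finsetSum S hD
  have hE : Integrable (fun y => log 2 * tot S a y + log S.card / (1 - t) *
        (tot S a y * (1 - ∑ i, (pm S a y i) ^ 2))) (_root_.stdGaussian N) :=
    (hT.const_mul _).add (hC.const_mul _)
  have := integral_mono (hA.sub hB) (hE.add hD') (fun y => pointwise_lower h hS a t ht y)
  simp only [Pi.add_apply, Pi.sub_apply] at this
  rw [integral_sub hA hB, integral_add hE hD', integral_sub hA'
    (integrable_const _), integral_add (hT.mul_const _) hT, integral_mul_const, integral_tot,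
    integral_finsetSum _ hi1, Finset.sum_congr rfl hv1, integral_finsetSum _ hD,
    integral_add (hT.const_mul _) (hC.const_mul _), integral_const_mul, integral_const_mul,
    integral_tot] at this
  simp only [integral_mul_const, integral_lik, integral_const, probReal_univ, smul_eq_mul, one_mul,
    Finset.sum_const, nsmul_eq_mul] at this
  have e : ∫ y, tot S a y * (1 - ∑ i, (pm S a y i) ^ 2) ∂(_root_.stdGaussian N) =
      S.card * mmse N S lam := by
    rw [mmse_eq hS h, ← ha, ← mul_assoc, mul_inv_cancel₀ hM.ne', one_mul]
  rw [e] at this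
  have e2 : ∑ u ∈ S, log (nbr S t u).card = (S.card : ℝ) *
      ((S.card : ℝ)⁻¹ * ∑ u ∈ S, log (nbr S t u).card) := by
    rw [← mul_assoc, mul_inv_cancel₀ hM.ne', one_mul]
  rw [e2] at this
  refine le_of_mul_le_mul_left ?_ hM
  linarith

/-! ### Spread assumption -/

lemma unifOn_apply {N : ℕ} (S : Finset (V N)) (A : Set (V N)) (hA : MeasurableSet A)
    [DecidablePred (· ∈ A)] :
    unifOn S A = (S.card : ℝ≥0∞)⁻¹ * ((S.filter (· ∈ A)).card : ℝ≥0∞) := by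
  unfold unifOn
  rw [Measure.smul_apply, Measure.finsetSum_apply, smul_eq_mul]
  congr 1
  simp_rw [Measure.dirac_apply' _ hA, Set.indicator_apply]
  simp

instance {N : ℕ} (S : Finset (V N)) : SFinite (unifOn S) := by
  unfold unifOn; infer_instance

lemma overlap_eq {N : ℕ} (S : Finset (V N)) (t : ℝ) :
    ((unifOn S).prod (unifOn S)) {q | t ≤ inp q.1 q.2} =
      (S.card : ℝ≥0∞)⁻¹ * ((S.card : ℝ≥0∞)⁻¹ * ∑ u ∈ S, ((nbr S t u).card : ℝ≥0∞)) := by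
  classical
  have hm : Measurable (fun q : V N × V N => inp q.1 q.2) := by
    unfold inp
    exact Finset.measurable_fun_sum _ fun i _ =>
      ((measurable_pi_apply i).comp measurable_fst).mul ((measurable_pi_apply i).comp measurable_snd)
  have hA : MeasurableSet {q : V N × V N | t ≤ inp q.1 q.2} := measurableSet_le measurable_const hm
  have : (unifOn S).prod (unifOn S) =
      (S.card : ℝ≥0∞)⁻¹ • ∑ x ∈ S, (unifOn S).map (Prod.mk x) := by
    conv_lhs => enter [1]; unfold unifOn
    rw [Measure.prod_smul_left, finset_sum_prod]
  rw [this, Measure.smul_apply, Measure.finsetSum_apply, smul_eq_mul]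
  congr 1
  rw [Finset.mul_sum]
  refine Finset.sum_congr rfl fun x _ => ?_
  rw [Measure.map_apply measurable_prodMk_left hA, unifOn_apply _ _ (measurable_prodMk_left hA)]
  congr 3
  ext u
  simp only [nbr, Finset.mem_filter, Set.mem_preimage, Set.mem_ofPred_eq, inp_comm' x u]

lemma avg_log_le {N : ℕ} {S : Finset (V N)} (h : onSphere S) (hS : S.Nonempty) (t : ℝ) (ht : t < 1)
    (η : ℝ) (hb : ((unifOn S).prod (unifOn S)) {q | t ≤ inp q.1 q.2} ≤
      (S.card : ℝ≥0∞) ^ (-1 + η)) :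
    (S.card : ℝ)⁻¹ * ∑ u ∈ S, log (nbr S t u).card ≤ η * log S.card := by
  have hM : (0 : ℝ) < S.card := by exact_mod_cast hS.card_pos
  rw [overlap_eq] at hb
  have hfin : (S.card : ℝ≥0∞) ^ (-1 + η) ≠ ⊤ := by
    refine ENNReal.rpow_ne_top_of_ne_zero ?_ (by simp)
    simp [hS.ne_empty]
  have hr := ENNReal.toReal_mono hfin hb
  rw [ENNReal.toReal_mul, ENNReal.toReal_mul, ENNReal.toReal_inv, ENNReal.toReal_natCast,
    ENNReal.toReal_sum (by simp), ← ENNReal.toReal_rpow, ENNReal.toReal_natCast] at hr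
  simp only [ENNReal.toReal_natCast] at hr
  rw [Real.rpow_add hM, Real.rpow_neg_one] at hr
  have hr2 := le_of_mul_le_mul_left hr (inv_pos.2 hM)
  have hexp : (S.card : ℝ) ^ η = exp (η * log S.card) := by
    rw [Real.rpow_def_of_pos hM, mul_comm]
  rw [hexp] at hr2
  set c := η * log S.card with hc
  have hpt : ∀ u ∈ S, log (nbr S t u).card ≤ c - 1 + (nbr S t u).card * exp (-c) := by
    intro u hu
    have hu' : u ∈ nbr S t u := by
      classical
      simp only [nbr, Finset.mem_filter]
      exact ⟨hu, by rw [inp_self (h u hu)]; exact ht.le⟩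
    have hB : (0 : ℝ) < (nbr S t u).card := by exact_mod_cast Finset.card_pos.2 ⟨u, hu'⟩
    have := Real.log_le_sub_one_of_pos (mul_pos hB (exp_pos (-c)))
    rw [Real.log_mul hB.ne' (exp_pos _).ne', Real.log_exp] at this
    linarith
  have hs := Finset.sum_le_sum hpt
  rw [Finset.sum_add_distrib, ← Finset.sum_mul, Finset.sum_const, nsmul_eq_mul] at hs
  have hs2 := mul_le_mul_of_nonneg_left hs (inv_pos.2 hM).le
  have e : (S.card : ℝ)⁻¹ * (S.card * (c - 1) + (∑ u ∈ S, ((nbr S t u).card : ℝ)) * exp (-c)) =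
      c - 1 + ((S.card : ℝ)⁻¹ * ∑ u ∈ S, ((nbr S t u).card : ℝ)) * exp (-c) := by
    field_simp
  rw [e] at hs2
  have h3 := mul_le_mul_of_nonneg_right hr2 (exp_pos (-c)).le
  rw [← Real.exp_add, add_neg_cancel, Real.exp_zero] at h3
  linarith


/-- Under the spread assumption and `M_N → ∞`, if the all-or-nothing
phenomenon holds with critical SNR sequence `λ_N`, then `λ_N / (2 log M_N) → 1`. -/
theorem statement1 (S : ∀ N : ℕ, Finset (V N)) (hsphere : ∀ N, onSphere (S N))
    (hM : Tendsto (fun N => (S N).card) atTop atTop)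
    (hspread : spread S)
    (lam : ℕ → ℝ) (hpos : ∀ N, 0 < lam N)
    (hAoN : allOrNothing S lam) :
    Tendsto (fun N => lam N / (2 * Real.log (S N).card)) atTop (nhds 1) := by
  have hMr : Tendsto (fun N => ((S N).card : ℝ)) atTop atTop :=
    tendsto_natCast_atTop_atTop.comp hM
  have hL : Tendsto (fun N => Real.log (S N).card) atTop atTop :=
    Real.tendsto_log_atTop.comp hMr
  have hne : ∀ᶠ N in atTop, (S N).Nonempty := by
    filter_upwards [hM.eventually_ge_atTop 1] with N hN
    exact Finset.card_pos.1 hN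
  obtain ⟨hlow, hhigh⟩ := hAoN
  rw [tendsto_order]
  constructor
  · intro b hb
    rcases le_or_gt b 0 with hb0 | hb0
    · filter_upwards [hL.eventually_gt_atTop 0] with N hN
      exact lt_of_le_of_lt hb0 (div_pos (hpos N) (by linarith))
    · set β := (1 + b) / (2 * b) with hβ
      have hβb : β * b = (1 + b) / 2 := by rw [hβ]; field_simp
      have hβ1 : 1 < β := by rw [hβ, lt_div_iff₀ (by linarith)]; linarith
      set κ := (1 - b) / 2 with hκ
      have hκ0 : 0 < κ := by rw [hκ]; linarith
      obtain ⟨t₀, ht₀, hsp⟩ := hspread (κ / 8) (by linarith)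
      set t := (t₀ + 1) / 2 with htdef
      have ht1 : t < 1 := by rw [htdef]; linarith
      have h1t : 0 < 1 - t := by linarith
      have hov := hsp t (by rw [htdef]; linarith) ht1 (κ / 8) (by linarith)
      have hm := (hhigh β hβ1).eventually_lt_const (mul_pos h1t (by linarith : 0 < κ / 4))
      filter_upwards [hne, hov, hm, hL.eventually_gt_atTop 0,
        hL.eventually_gt_atTop (Real.log 2 / (κ / 4))] with N hS ho hmm hL0 hL2
      rw [lt_div_iff₀ (by linarith)]
      by_contra hcon
      push Not at hcon
      rw [add_assoc] at ho
      have hav := avg_log_le (hsphere N) hS t ht1 _ ho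
      have hlb := lower_bound hS (hsphere N) (β * lam N)
        (mul_nonneg (by linarith) (hpos N).le) t ht1
      rw [div_lt_iff₀ (by linarith)] at hL2
      have h1 : Real.log (S N).card / (1 - t) * mmse N (S N) (β * lam N) ≤
          Real.log (S N).card * (κ / 4) := by
        rw [div_mul_eq_mul_div, div_le_iff₀ h1t]
        have := mul_le_mul_of_nonneg_left hmm.le hL0.le
        linarith
      have h2 : β * lam N ≤ β * (b * (2 * Real.log (S N).card)) :=
        mul_le_mul_of_nonneg_left hcon (by linarith)
      have h3 : β * (b * (2 * Real.log (S N).card)) = (1 + b) * Real.log (S N).card := by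
        rw [← mul_assoc, hβb]; ring
      have h4 : (1 + b) = 2 - 2 * κ := by rw [hκ]; ring
      rw [h3, h4] at h2
      nlinarith [mul_pos hκ0 hL0]
  · intro b hb
    set β := 2 / (1 + b) with hβ
    have hβ0 : 0 < β := by rw [hβ]; exact div_pos two_pos (by linarith)
    have hβ1 : β < 1 := by rw [hβ, div_lt_one (by linarith)]; linarith
    have hβb : 1 < β * b := by
      rw [hβ, div_mul_eq_mul_div, lt_div_iff₀ (by linarith)]; linarith
    set δ := (1 - 1 / (β * b)) / 4 with hδ
    have hδ0 : 0 < δ := by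
      have : 1 / (β * b) < 1 := by rw [div_lt_one (by linarith)]; exact hβb
      rw [hδ]; linarith
    have hδ1 : β * b * (1 - 2 * δ) = (β * b + 1) / 2 := by
      have : β * b ≠ 0 := by linarith
      rw [hδ]; field_simp; ring
    have hm := (hlow β hβ0.le hβ1).eventually_const_lt (by linarith : 1 - δ < 1)
    filter_upwards [hne, hm, hL.eventually_gt_atTop 0] with N hS hmm hL0
    rw [div_lt_iff₀ (by linarith)]
    by_contra hcon
    push Not at hcon
    have hub := upper_bound hS (hsphere N) (β * lam N) (mul_nonneg hβ0.le (hpos N).le)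
    have h1 : β * lam N * (1 - mmse N (S N) (β * lam N)) ≤ β * lam N * δ :=
      mul_le_mul_of_nonneg_left (by linarith) (mul_nonneg hβ0.le (hpos N).le)
    have h2δ : 0 < 1 - 2 * δ := by
      have : 0 < β * b * (1 - 2 * δ) := by rw [hδ1]; linarith
      exact pos_of_mul_pos_right this (by linarith)
    have h2 : β * (1 - 2 * δ) * (b * (2 * Real.log (S N).card)) ≤ β * (1 - 2 * δ) * lam N :=
      mul_le_mul_of_nonneg_left hcon (mul_pos hβ0 h2δ).le
    have h3 : β * (1 - 2 * δ) * (b * (2 * Real.log (S N).card)) =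
        (β * b + 1) * Real.log (S N).card := by
      calc _ = (β * b * (1 - 2 * δ)) * (2 * Real.log (S N).card) := by ring
        _ = _ := by rw [hδ1]; ring
    rw [h3] at h2
    nlinarith [mul_pos (sub_pos.2 hβb) hL0]
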